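/- arXiv:2307.13535 — 2 statements merged into one kernel-verified Lean document; each statement's English description precedes it below -/
import Mathlib

section
/- Let v* ∈ 𝓜 ∩ S^{d−1}, λ > 0, Σ := λ v* v*ᵀ + I_d, let Σ̂ be a symmetric positive semidefinite d×d matrix, and W := Σ̂ − Σ. Suppose λ > 2ρ(W, F*) and t2(λ) < 1, and suppose the initialization satisfies v_0 ∈ 𝔾(λ). Then the projected power iterates satisfy, for all t ≥ 1, ‖v_{t+1} − v*‖₂ ≤ 2^{−t} · ‖v_0 − v*‖₂ + 6ρ(W, F*)/(λ − 2ρ(W, F*)). -/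
open MeasureTheory ProbabilityTheory Matrix Finset

noncomputable section

namespace StructuredPCA

/-- Euclidean inner product on `Fin d → ℝ`. -/
def ip {d : ℕ} (u v : Fin d → ℝ) : ℝ := ∑ i, u i * v i

/-- Euclidean norm on `Fin d → ℝ`. -/
def nrm {d : ℕ} (v : Fin d → ℝ) : ℝ := Real.sqrt (∑ i, v i ^ 2)

/-- Quadratic form `vᵀ A v`. -/
def quad {d : ℕ} (A : Matrix (Fin d) (Fin d) ℝ) (v : Fin d → ℝ) : ℝ := ip v (A.mulVec v)

/-- `ρ(A, S) = sup { |vᵀ A v| : v ∈ S, ‖v‖ = 1 }`. -/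
def rho {d : ℕ} (A : Matrix (Fin d) (Fin d) ℝ) (S : Set (Fin d → ℝ)) : ℝ :=
  sSup {x : ℝ | ∃ v ∈ S, nrm v = 1 ∧ x = |quad A v|}

/-- Frobenius norm of a matrix. -/
def frob {d : ℕ} (A : Matrix (Fin d) (Fin d) ℝ) : ℝ :=
  Real.sqrt (∑ i, ∑ j, A i j ^ 2)

/-- Operator (spectral) norm of a matrix. -/
def opNorm {d : ℕ} (A : Matrix (Fin d) (Fin d) ℝ) : ℝ :=
  sSup {x : ℝ | ∃ v, nrm v = 1 ∧ x = nrm (A.mulVec v)}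

/-- The spiked covariance `λ v* v*ᵀ + I`. -/
def spikedCov {d : ℕ} (lam : ℝ) (vstar : Fin d → ℝ) : Matrix (Fin d) (Fin d) ℝ :=
  lam • vecMulVec vstar vstar + 1

/-- `x 1, …, x n` are spiked Wishart samples with spike `v*`:
`x i = √λ g i • v* + z i` with `g, z` i.i.d. standard normal, mutually independent. -/
def IsSpikedWishart {d n : ℕ} {Ω : Type*} [MeasurableSpace Ω] (μ : Measure Ω)
    (lam : ℝ) (vstar : Fin d → ℝ) (x : Fin n → Ω → Fin d → ℝ) : Prop :=
  ∃ G : (Fin n ⊕ Fin n × Fin d) → Ω → ℝ,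
    (∀ i, Measurable (G i)) ∧
    iIndepFun G μ ∧
    (∀ i, μ.map (G i) = gaussianReal 0 1) ∧
    ∀ i ω j, x i ω j = Real.sqrt lam * G (Sum.inl i) ω * vstar j + G (Sum.inr (i, j)) ω

/-- The sample covariance matrix `n⁻¹ ∑ xᵢ xᵢᵀ`. -/
def sampleCov {d n : ℕ} {Ω : Type*} (x : Fin n → Ω → Fin d → ℝ) (ω : Ω) :
    Matrix (Fin d) (Fin d) ℝ :=
  (n : ℝ)⁻¹ • ∑ i, vecMulVec (x i ω) (x i ω)

/-- Union-of-linear-structures data: an orthonormal basis `φ` and subsets `Bs m`. -/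
structure UnionStruct (d M : ℕ) where
  φ : Fin d → Fin d → ℝ
  orthonormal : ∀ i j, ip (φ i) (φ j) = if i = j then 1 else 0
  Bs : Fin M → Finset (Fin d)

/-- The subspace `L m = span (B m)`. -/
def UnionStruct.L {d M : ℕ} (U : UnionStruct d M) (m : Fin M) : Submodule ℝ (Fin d → ℝ) :=
  Submodule.span ℝ (U.φ '' (U.Bs m : Set (Fin d)))

/-- The union `𝓜 = ⋃ m, L m`. -/
def UnionStruct.carrier {d M : ℕ} (U : UnionStruct d M) : Set (Fin d → ℝ) :=
  ⋃ m, (U.L m : Set (Fin d → ℝ))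

/-- A `(d,k)`-layered graph. -/
structure LayeredGraph (d k : ℕ) where
  vs : Fin d
  vt : Fin d
  hst : vs ≠ vt
  V : Fin k → Finset (Fin d)
  hvs : ∀ j, vs ∉ V j
  hvt : ∀ j, vt ∉ V j
  hdisj : ∀ j j', j ≠ j' → Disjoint (V j) (V j')
  hdvd : k ∣ (d - 2)
  hcard : ∀ j, (V j).card = (d - 2) / k
  hcover : ∀ i, i ≠ vs → i ≠ vt → ∃ j, i ∈ V j

/-- A member of `P^k`: contains `v_s`, `v_t` and exactly one vertex of each layer. -/
def LayeredGraph.IsPathSet {d k : ℕ} (G : LayeredGraph d k) (P : Finset (Fin d)) : Prop :=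
  G.vs ∈ P ∧ G.vt ∈ P ∧ ∀ j, (P ∩ G.V j).card = 1

/-- `v` is `k`-path-sparse. -/
def LayeredGraph.PathSparse {d k : ℕ} (G : LayeredGraph d k) (v : Fin d → ℝ) : Prop :=
  ∃ P, G.IsPathSet P ∧ ∀ i, v i ≠ 0 → i ∈ P

/-- A member of `T^k`: a `k`-element rooted connected subtree of the complete binary
tree on nodes `1, …, d` (node `i ≥ 2` has parent `i / 2`). -/
def IsTreeSet (d k : ℕ) (T : Finset ℕ) : Prop :=
  T.card = k ∧ 1 ∈ T ∧ (∀ i ∈ T, 1 ≤ i ∧ i ≤ d) ∧ ∀ i ∈ T, 2 ≤ i → i / 2 ∈ T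

/-- `v` is `k`-tree-sparse (coordinate `i : Fin d` corresponds to node `i + 1`). -/
def TreeSparse (d k : ℕ) (v : Fin d → ℝ) : Prop :=
  ∃ T, IsTreeSet d k T ∧ ∀ i : Fin d, v i ≠ 0 → (i : ℕ) + 1 ∈ T

/-- The index of the parent node: coordinate `i` is node `i+1`, whose parent is `(i+1)/2`. -/
def parentIdx {d : ℕ} (i : Fin d) : Fin d :=
  ⟨((i : ℕ) + 1) / 2 - 1, by have := i.isLt; omega⟩

/-- The feasible set of the SDP relaxation for tree-sparse PCA. -/
def sdpFeasible (d k : ℕ) : Set (Matrix (Fin d) (Fin d) ℝ) :=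
  {Mm | Mm.PosSemidef ∧ (∑ i, Mm i i) = 1 ∧ (∑ i, ∑ j, |Mm i j|) ≤ (k : ℝ) ∧
    ∀ i : Fin d, 2 ≤ (i : ℕ) + 1 → Mm i i ≤ Mm (parentIdx i) (parentIdx i)}


lemma ip_eq {d : ℕ} (u v : Fin d → ℝ) : ip u v = u ⬝ᵥ v := rfl

lemma nrm_sq {d : ℕ} (v : Fin d → ℝ) : nrm v ^ 2 = v ⬝ᵥ v := by
  unfold nrm
  rw [Real.sq_sqrt (Finset.sum_nonneg fun i _ => sq_nonneg _)]
  simp [dotProduct, sq]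

lemma nrm_nonneg {d : ℕ} (v : Fin d → ℝ) : 0 ≤ nrm v := Real.sqrt_nonneg _

lemma rho_bdd {d : ℕ} (A : Matrix (Fin d) (Fin d) ℝ) (S : Set (Fin d → ℝ)) :
    BddAbove {x : ℝ | ∃ v ∈ S, nrm v = 1 ∧ x = |quad A v|} := by
  refine ⟨∑ i, ∑ j, |A i j|, ?_⟩
  rintro x ⟨v, -, hv, rfl⟩
  have hc : ∀ i, |v i| ≤ 1 := by
    intro i
    have h1 : ∑ i, v i ^ 2 = 1 := by
      have := nrm_sq v
      rw [hv] at this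
      simp only [dotProduct] at this
      simp only [sq]
      linarith
    have h2 : v i ^ 2 ≤ ∑ i, v i ^ 2 :=
      Finset.single_le_sum (f := fun i => v i ^ 2) (fun i _ => sq_nonneg _) (Finset.mem_univ i)
    rw [h1] at h2
    exact (sq_le_one_iff_abs_le_one _).1 h2
  have e : quad A v = ∑ i, ∑ j, v i * (A i j * v j) := by
    simp [quad, ip, Matrix.mulVec, dotProduct, Finset.mul_sum]
  rw [e]
  refine (Finset.abs_sum_le_sum_abs _ _).trans (Finset.sum_le_sum fun i _ => ?_)
  refine (Finset.abs_sum_le_sum_abs _ _).trans (Finset.sum_le_sum fun j _ => ?_)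
  rw [abs_mul, abs_mul]
  have h1 := hc i
  have h2 := hc j
  have h3 : |A i j| * |v j| ≤ |A i j| := mul_le_of_le_one_right (abs_nonneg _) h2
  have h4 : 0 ≤ |A i j| * |v j| := by positivity
  exact (mul_le_of_le_one_left h4 h1).trans h3

lemma rho_nonneg {d : ℕ} (A : Matrix (Fin d) (Fin d) ℝ) (S : Set (Fin d → ℝ)) :
    0 ≤ rho A S := by
  apply Real.sSup_nonneg
  rintro x ⟨v, -, -, rfl⟩
  exact abs_nonneg _

lemma quad_le {d : ℕ} (A : Matrix (Fin d) (Fin d) ℝ) (F : Submodule ℝ (Fin d → ℝ))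
    (w : Fin d → ℝ) (hw : w ∈ F) :
    |w ⬝ᵥ A.mulVec w| ≤ rho A (F : Set (Fin d → ℝ)) * (w ⬝ᵥ w) := by
  by_cases h0 : nrm w = 0
  · have h1 : w ⬝ᵥ w = 0 := by rw [← nrm_sq, h0]; simp
    have : w = 0 := dotProduct_self_eq_zero.1 h1
    subst this
    simp
  · have hpos : 0 < nrm w := lt_of_le_of_ne (nrm_nonneg w) (Ne.symm h0)
    have hu : nrm ((nrm w)⁻¹ • w) = 1 := by
      have := nrm_sq ((nrm w)⁻¹ • w)
      rw [smul_dotProduct, dotProduct_smul, ← nrm_sq, smul_eq_mul, smul_eq_mul] at this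
      have h2 : nrm ((nrm w)⁻¹ • w) ^ 2 = 1 := by rw [this]; field_simp
      exact (pow_eq_one_iff_of_nonneg (nrm_nonneg _) two_ne_zero).1 h2
    have h3 : |quad A ((nrm w)⁻¹ • w)| ≤ rho A (F : Set (Fin d → ℝ)) :=
      le_csSup (rho_bdd A _) ⟨_, F.smul_mem _ hw, hu, rfl⟩
    have h4 : quad A ((nrm w)⁻¹ • w) = (nrm w ^ 2)⁻¹ * (w ⬝ᵥ A.mulVec w) := by
      rw [quad, ip_eq, mulVec_smul, smul_dotProduct, dotProduct_smul, smul_eq_mul, smul_eq_mul]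
      field_simp
    rw [h4, abs_mul, abs_of_pos (by positivity : 0 < (nrm w ^ 2)⁻¹)] at h3
    rw [← nrm_sq]
    rw [inv_mul_le_iff₀ (by positivity)] at h3
    linarith

lemma bil_le {d : ℕ} (A : Matrix (Fin d) (Fin d) ℝ) (hA : Aᵀ = A)
    (F : Submodule ℝ (Fin d → ℝ))
    (u x : Fin d → ℝ) (hu : u ∈ F) (hx : x ∈ F) (hx1 : nrm x = 1) (r : ℝ)
    (hr : rho A (F : Set (Fin d → ℝ)) ≤ r) :
    u ⬝ᵥ A.mulVec x ≤ r * nrm u := by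
  rcases (nrm_nonneg u).eq_or_lt with h0 | hpos
  · have h1 : u ⬝ᵥ u = 0 := by rw [← nrm_sq, ← h0]; simp
    have : u = 0 := dotProduct_self_eq_zero.1 h1
    rw [← h0, this]; simp
  · set e := nrm u with he
    have hxx : x ⬝ᵥ x = 1 := by rw [← nrm_sq, hx1]; simp
    have huu : u ⬝ᵥ u = e ^ 2 := by rw [← nrm_sq]
    have hp := (le_abs_self _).trans (quad_le A F (u + e • x) (F.add_mem hu (F.smul_mem e hx)))
    have hm := (neg_le_abs _).trans (quad_le A F (u - e • x) (F.sub_mem hu (F.smul_mem e hx)))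
    have hsym : x ⬝ᵥ A.mulVec u = u ⬝ᵥ A.mulVec x := by
      rw [dotProduct_mulVec, ← mulVec_transpose, hA, dotProduct_comm]
    have hux : x ⬝ᵥ u = u ⬝ᵥ x := dotProduct_comm _ _
    simp only [mulVec_add, mulVec_sub, mulVec_smul, add_dotProduct, dotProduct_add,
      sub_dotProduct, dotProduct_sub, smul_dotProduct, dotProduct_smul, smul_eq_mul,
      hsym, hux, hxx, huu] at hp hm
    have h5 : 4 * e * (u ⬝ᵥ A.mulVec x) ≤ 4 * e * (rho A (F : Set (Fin d → ℝ)) * e) := by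
      linarith
    have h6 := le_of_mul_le_mul_left h5 (by positivity)
    exact h6.trans (by gcongr)

set_option maxHeartbeats 1000000 in
/-- The scalar analysis of one projected power step. -/
lemma scalar_step (lam r a b ex ey : ℝ) (hr : 0 ≤ r) (hgap : 2 * r < lam)
    (ht2 : 4 / (lam + 1 - r) + 10 * r / (lam - 2 * r) < 1)
    (ha : 4 / (lam + 1 - r) + 5 * r / (lam - 2 * r) ≤ a)
    (hex0 : 0 ≤ ex) (hey0 : 0 ≤ ey) (hex : ex ^ 2 = 2 * (1 - a)) (hey : ey ^ 2 = 2 * (1 - b))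
    (hstep : (lam * a + 1) * ey ≤ 2 * (ex + r)) :
    4 / (lam + 1 - r) + 5 * r / (lam - 2 * r) ≤ b ∧ 3 / 4 ≤ b ∧
    ey ≤ ex + 6 * r / (lam - 2 * r) ∧
    (3 / 4 ≤ a → ey ≤ ex / 2 + 6 * r / (lam - 2 * r) / 2) := by
  have hD : 0 < lam - 2 * r := by linarith
  have hE : 0 < lam + 1 - r := by linarith
  obtain ⟨q, hq⟩ : ∃ q, q = r / (lam - 2 * r) := ⟨_, rfl⟩
  have hq0 : 0 ≤ q := by rw [hq]; positivity
  have hqD : q * (lam - 2 * r) = r := by rw [hq]; exact div_mul_cancel₀ _ hD.ne'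
  obtain ⟨p, hp⟩ : ∃ p, p = 4 / (lam + 1 - r) := ⟨_, rfl⟩
  have hp0 : 0 < p := by rw [hp]; positivity
  have hpE : p * (lam + 1 - r) = 4 := by rw [hp]; exact div_mul_cancel₀ _ hE.ne'
  have e5 : 5 * r / (lam - 2 * r) = 5 * q := by rw [hq]; ring
  have e6 : 6 * r / (lam - 2 * r) = 6 * q := by rw [hq]; ring
  have e10 : 10 * r / (lam - 2 * r) = 10 * q := by rw [hq]; ring
  rw [← hp, e10] at ht2
  rw [← hp, e5] at ha
  rw [← hp, e5, e6]
  clear e5 e6 e10 hp hq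
  have hlam : 3 + r < lam := by nlinarith
  have hp3 : 3 ≤ p * lam := by nlinarith
  have hqr : r ≤ q * lam := by nlinarith
  have hla : 3 + 5 * r ≤ lam * a := by nlinarith
  have ha0 : 0 < a := by linarith
  -- main bound
  have hm : (4 + 5 * r) * ey ≤ 2 * (ex + r) := by nlinarith
  have hmax : ey ≤ ex / 2 ∨ ey ≤ 2 / 5 := by
    by_contra! h
    nlinarith [mul_nonneg hr (by linarith : (0:ℝ) ≤ ey - 2 / 5)]
  have hb34 : 3 / 4 ≤ b := by
    rcases hmax with h | h <;> nlinarith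
  have hcontr : 3 / 4 ≤ a → ey ≤ ex / 2 + 6 * q / 2 := by
    intro h
    by_contra! hc
    have h1 : 3 / 4 * lam * ey ≤ lam * a * ey := by
      have : 3 / 4 * lam ≤ lam * a := by nlinarith
      gcongr
    have h3 : 4 * (ey - ex / 2) ≤ (lam * a + 1) * (ey - ex / 2) := by
      have : 0 ≤ ey - ex / 2 := by linarith
      gcongr; linarith
    have h4 : (lam * a + 1) * (ey - ex / 2) ≤ 2 * r := by nlinarith
    have h5 : (3 / 4 * lam) * (3 * q) ≤ (lam * a + 1) * (ey - ex / 2) := by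
      have h6 : 3 / 4 * lam ≤ lam * a + 1 := by nlinarith
      have h7 : 3 * q ≤ ey - ex / 2 := by linarith
      exact mul_le_mul h6 h7 (by positivity) (by linarith)
    have h8 : (3 / 4 * lam) * (3 * q) < (lam * a + 1) * (ey - ex / 2) := by
      have h6 : 3 / 4 * lam ≤ lam * a + 1 := by nlinarith
      have h7 : 3 * q < ey - ex / 2 := by linarith
      exact mul_lt_mul' h6 h7 (by positivity) (by linarith)
    nlinarith
  refine ⟨?_, hb34, ?_, hcontr⟩
  · rcases le_or_gt a b with h | h
    · linarith
    · have hxy : ex < ey := lt_of_pow_lt_pow_left₀ 2 hey0 (by linarith)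
      have hy : ey ≤ 2 / 5 := by
        rcases hmax with h | h
        · linarith
        · exact h
      have ha92 : 0.92 ≤ a := by
        have : ex ^ 2 ≤ (2 / 5) ^ 2 := by gcongr; linarith
        linarith
      have h1 : (lam * a - 1) * ey ≤ 2 * r := by linarith
      have h2 : 0.58 * lam ≤ lam * a - 1 := by
        have : lam * 0.92 ≤ lam * a := mul_le_mul_of_nonneg_left ha92 (by linarith)
        linarith
      have h3 : 0.58 * lam * ey ≤ 2 * r := (mul_le_mul_of_nonneg_right h2 hey0).trans h1
      have h4 : 1 - b ≤ 0.2 * ey := by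
        have := mul_nonneg hey0 (by linarith : 0 ≤ 2 / 5 - ey)
        linarith
      have h5 : ey ≤ 5 * q := by
        by_contra! hc
        have : lam * (5 * q) < lam * ey := by
          apply mul_lt_mul_of_pos_left hc; linarith
        linarith
      linarith
  · rcases le_or_gt (3 / 4) a with h | h
    · have := hcontr h; linarith
    · have : 2 / 5 ≤ ex := by nlinarith
      rcases hmax with h | h <;> linarith

/-- Theorem 2: geometric convergence of the projected power method
from an initialization in the good region `𝔾(λ)`. -/
theorem projected_power_method_convergence
    {d M : ℕ} (U : UnionStruct d M)
    (vstar : Fin d → ℝ) (hvstar_mem : vstar ∈ U.carrier) (hvstar_nrm : nrm vstar = 1)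
    (lam : ℝ) (hlam : 0 < lam)
    (Sighat : Matrix (Fin d) (Fin d) ℝ) (hpsd : Sighat.PosSemidef)
    (W : Matrix (Fin d) (Fin d) ℝ) (hW : W = Sighat - spikedCov lam vstar)
    (Fstar : Submodule ℝ (Fin d → ℝ))
    (hFstar_form : ∃ m1 m2 m3 : Fin M, Fstar = U.L m1 ⊔ U.L m2 ⊔ U.L m3)
    (hFstar_max : ∀ m1 m2 m3 : Fin M,
      rho W ((U.L m1 ⊔ U.L m2 ⊔ U.L m3 : Submodule ℝ (Fin d → ℝ)) : Set (Fin d → ℝ)) ≤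
        rho W (Fstar : Set (Fin d → ℝ)))
    (hgap : 2 * rho W (Fstar : Set (Fin d → ℝ)) < lam)
    (ht2 : 4 / (lam + 1 - rho W (Fstar : Set (Fin d → ℝ))) +
        10 * rho W (Fstar : Set (Fin d → ℝ)) / (lam - 2 * rho W (Fstar : Set (Fin d → ℝ))) < 1)
    (v : ℕ → Fin d → ℝ)
    (hmem : ∀ t, v t ∈ U.carrier ∧ nrm (v t) = 1)
    (hiter : ∀ t, ∀ u ∈ U.carrier, nrm u = 1 →
        ip u (Sighat.mulVec (v t)) ≤ ip (v (t + 1)) (Sighat.mulVec (v t)))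
    (hinit : 4 / (lam + 1 - rho W (Fstar : Set (Fin d → ℝ))) +
        5 * rho W (Fstar : Set (Fin d → ℝ)) / (lam - 2 * rho W (Fstar : Set (Fin d → ℝ))) ≤
          ip (v 0) vstar) :
    ∀ t : ℕ, 1 ≤ t →
      nrm (v (t + 1) - vstar) ≤
        (1 / 2) ^ t * nrm (v 0 - vstar) +
          6 * rho W (Fstar : Set (Fin d → ℝ)) / (lam - 2 * rho W (Fstar : Set (Fin d → ℝ))) := by
  have hWs : Wᵀ = W := by
    have h1 : Sighatᵀ = Sighat := by
      have := hpsd.isHermitian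
      simpa [Matrix.IsHermitian, conjTranspose_eq_transpose_of_trivial] using this
    rw [hW, transpose_sub, h1, spikedCov, transpose_add, transpose_smul, transpose_one,
      transpose_vecMulVec]
  set r := rho W (Fstar : Set (Fin d → ℝ)) with hrdef
  have hr : 0 ≤ r := rho_nonneg _ _
  have hss : vstar ⬝ᵥ vstar = 1 := by rw [← nrm_sq, hvstar_nrm]; simp
  have hvv : ∀ t, v t ⬝ᵥ v t = 1 := fun t => by rw [← nrm_sq, (hmem t).2]; simp
  have hsq : ∀ t, nrm (v t - vstar) ^ 2 = 2 * (1 - ip (v t) vstar) := by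
    intro t
    rw [nrm_sq, ip_eq]
    simp only [sub_dotProduct, dotProduct_sub, hss, hvv, dotProduct_comm vstar (v t)]
    ring
  have hstep : ∀ t, (lam * ip (v t) vstar + 1) * nrm (v (t + 1) - vstar) ≤
      2 * (nrm (v t - vstar) + r) := by
    intro t
    set ex := nrm (v t - vstar) with hex
    set ey := nrm (v (t + 1) - vstar) with hey
    have hopt := hiter t vstar hvstar_mem hvstar_nrm
    have hS : Sighat = lam • vecMulVec vstar vstar + 1 + W := by
      rw [hW, spikedCov]; abel
    have hSx : Sighat.mulVec (v t) =
        (lam * (v t ⬝ᵥ vstar)) • vstar + v t + W.mulVec (v t) := by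
      rw [hS, add_mulVec, add_mulVec, one_mulVec, smul_mulVec, vecMulVec_mulVec]
      congr 2
      ext i
      simp [dotProduct_comm vstar (v t)]
      ring
    obtain ⟨m1, h1⟩ := Set.mem_iUnion.1 (hmem t).1
    obtain ⟨m2, h2⟩ := Set.mem_iUnion.1 (hmem (t + 1)).1
    obtain ⟨m3, h3⟩ := Set.mem_iUnion.1 hvstar_mem
    have hbil : (v (t + 1) - vstar) ⬝ᵥ W.mulVec (v t) ≤ r * ey := by
      refine bil_le W hWs (U.L m1 ⊔ U.L m2 ⊔ U.L m3) _ _ ?_ ?_ (hmem t).2 r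
        (hFstar_max m1 m2 m3)
      · exact Submodule.sub_mem _
          (Submodule.mem_sup_left (Submodule.mem_sup_right h2)) (Submodule.mem_sup_right h3)
      · exact Submodule.mem_sup_left (Submodule.mem_sup_left h1)
    have hcs : (v (t + 1) - vstar) ⬝ᵥ (v t - vstar) ≤ ex * ey := by
      have h := Finset.sum_mul_sq_le_sq_mul_sq Finset.univ (v (t + 1) - vstar) (v t - vstar)
      have h' : ((v (t + 1) - vstar) ⬝ᵥ (v t - vstar)) ^ 2 ≤ (ex * ey) ^ 2 := by
        rw [mul_pow, hex, hey, nrm_sq, nrm_sq, mul_comm]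
        simpa [dotProduct, sq] using h
      exact le_of_sq_le_sq h' (mul_nonneg (nrm_nonneg _) (nrm_nonneg _))
    have hy2 := hsq (t + 1)
    rw [← hey] at hy2
    rw [hSx] at hopt
    simp only [ip_eq, sub_dotProduct, dotProduct_sub, dotProduct_add, dotProduct_smul,
      smul_eq_mul, hss, dotProduct_comm vstar (v t)] at hopt hbil hcs hy2 ⊢
    have hfin : ey * ((lam * (v t ⬝ᵥ vstar) + 1) * ey) ≤ ey * (2 * (ex + r)) := by
      have : ey * ((lam * (v t ⬝ᵥ vstar) + 1) * ey) =
        (lam * (v t ⬝ᵥ vstar) + 1) * (2 * (1 - v (t + 1) ⬝ᵥ vstar)) := by rw [← hy2]; ring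
      rw [this]
      nlinarith
    rcases (nrm_nonneg (v (t + 1) - vstar)).eq_or_lt with h0 | hpos
    · rw [← hey] at h0
      rw [← h0]
      have : 0 ≤ ex := nrm_nonneg _
      linarith
    · exact le_of_mul_le_mul_left hfin hpos
  have hall := fun t h => scalar_step lam r (ip (v t) vstar) (ip (v (t + 1)) vstar) _ _ hr hgap
    ht2 h (nrm_nonneg _) (nrm_nonneg _) (hsq t) (hsq (t + 1)) (hstep t)
  have hinv : ∀ t, 4 / (lam + 1 - r) + 5 * r / (lam - 2 * r) ≤ ip (v t) vstar := by
    intro t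
    induction t with
    | zero => exact hinit
    | succ k ih => exact (hall k ih).1
  have hδ : 0 ≤ 6 * r / (lam - 2 * r) := div_nonneg (by linarith) (by linarith)
  have key : ∀ t : ℕ, nrm (v (t + 1) - vstar) ≤
      (1 / 2) ^ t * nrm (v 0 - vstar) + 6 * r / (lam - 2 * r) := by
    intro t
    induction t with
    | zero => simpa using (hall 0 (hinv 0)).2.2.1
    | succ k ih =>
      have h := (hall (k + 1) (hinv _)).2.2.2 (hall k (hinv k)).2.1
      rw [pow_succ]
      linarith
  exact fun t _ => key t

end StructuredPCA
end
end

section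
/- Let v* ∈ ℝ^d be a unit vector, λ > 0, Σ := λ v* v*ᵀ + I_d, let Σ̂ be a symmetric d×d matrix, and W := Σ̂ − Σ. Let F ⊆ ℝ^d be a linear subspace with v* ∈ F, and let v̂_F be a maximizer of v ↦ vᵀ Σ̂ v over F ∩ S^{d−1} satisfying ⟨v̂_F, v*⟩ ≥ 0. If λ > 2ρ(W, F), then ‖v̂_F − v*‖₂ ≤ ρ(W, F)/(λ − 2ρ(W, F)). -/
open MeasureTheory ProbabilityTheory Matrix Finset

noncomputable section

namespace StructuredPCA

lemma ip_comm' {d : ℕ} (u v : Fin d → ℝ) : ip u v = ip v u := by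
  simp only [ip, mul_comm]

lemma bil_symm {d : ℕ} (A : Matrix (Fin d) (Fin d) ℝ) (hA : A.IsSymm) (x y : Fin d → ℝ) :
    ip y (A.mulVec x) = ip x (A.mulVec y) := by
  change y ⬝ᵥ (A *ᵥ x) = x ⬝ᵥ (A *ᵥ y)
  rw [Matrix.dotProduct_mulVec, ← Matrix.mulVec_transpose, hA.eq, dotProduct_comm]

lemma bil_lin {d : ℕ} (A : Matrix (Fin d) (Fin d) ℝ) (a b a' b' : ℝ) (x y : Fin d → ℝ) :
    ip (a • x + b • y) (A.mulVec (a' • x + b' • y)) =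
      a * a' * quad A x + a * b' * ip x (A.mulVec y) + b * a' * ip y (A.mulVec x)
        + b * b' * quad A y := by
  change (a • x + b • y) ⬝ᵥ (A *ᵥ (a' • x + b' • y)) = a * a' * (x ⬝ᵥ (A *ᵥ x)) +
    a * b' * (x ⬝ᵥ (A *ᵥ y)) + b * a' * (y ⬝ᵥ (A *ᵥ x)) + b * b' * (y ⬝ᵥ (A *ᵥ y))
  simp only [Matrix.mulVec_add, Matrix.mulVec_smul, dotProduct_add, add_dotProduct,
    smul_dotProduct, dotProduct_smul, smul_eq_mul]
  ring

lemma quad_lin {d : ℕ} (A : Matrix (Fin d) (Fin d) ℝ) (hA : A.IsSymm) (a b : ℝ)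
    (x y : Fin d → ℝ) :
    quad A (a • x + b • y) =
      a ^ 2 * quad A x + 2 * a * b * ip x (A.mulVec y) + b ^ 2 * quad A y := by
  unfold quad
  rw [bil_lin, bil_symm A hA x y]
  unfold quad
  ring

lemma ip_lin {d : ℕ} (a b a' b' : ℝ) (x y : Fin d → ℝ) :
    ip (a • x + b • y) (a' • x + b' • y) =
      a * a' * ip x x + (a * b' + b * a') * ip x y + b * b' * ip y y := by
  have h := bil_lin (1 : Matrix (Fin d) (Fin d) ℝ) a b a' b' x y
  simp only [quad, Matrix.one_mulVec] at h
  rw [h, ip_comm' y x]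
  ring

lemma nrm_eq {d : ℕ} (v : Fin d → ℝ) : nrm v = Real.sqrt (ip v v) := by
  simp only [nrm, ip, sq]

lemma ip_self_nonneg {d : ℕ} (v : Fin d → ℝ) : 0 ≤ ip v v :=
  Finset.sum_nonneg fun i _ => mul_self_nonneg (v i)

lemma ip_self_of_nrm {d : ℕ} {v : Fin d → ℝ} (h : nrm v = 1) : ip v v = 1 := by
  rw [nrm_eq, Real.sqrt_eq_one] at h
  exact h

lemma quad_smul {d : ℕ} (A : Matrix (Fin d) (Fin d) ℝ) (a : ℝ) (x : Fin d → ℝ) :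
    quad A (a • x) = a ^ 2 * quad A x := by
  change (a • x) ⬝ᵥ (A *ᵥ (a • x)) = a ^ 2 * (x ⬝ᵥ (A *ᵥ x))
  simp only [Matrix.mulVec_smul, smul_dotProduct, dotProduct_smul, smul_eq_mul]
  ring

lemma quad_le_of_unit {d : ℕ} (A : Matrix (Fin d) (Fin d) ℝ)
    (F : Submodule ℝ (Fin d → ℝ)) (κ : ℝ)
    (h : ∀ v ∈ F, nrm v = 1 → quad A v ≤ κ) (v : Fin d → ℝ) (hv : v ∈ F) :
    quad A v ≤ κ * ip v v := by
  rcases (ip_self_nonneg v).eq_or_lt with h0 | h0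
  · have : v = 0 := by
      have : v ⬝ᵥ v = 0 := h0.symm
      exact dotProduct_self_eq_zero.mp this
    subst this
    simp [quad, ip]
  · set n := Real.sqrt (ip v v) with hn
    have hnpos : 0 < n := Real.sqrt_pos.mpr h0
    have hn2 : n ^ 2 = ip v v := Real.sq_sqrt h0.le
    have hnn : nrm (n⁻¹ • v) = 1 := by
      have := quad_smul (1 : Matrix (Fin d) (Fin d) ℝ) n⁻¹ v
      simp only [quad, Matrix.one_mulVec] at this
      rw [nrm_eq, this, Real.sqrt_eq_one, ← hn2]
      field_simp
    have h1 := h _ (F.smul_mem n⁻¹ hv) hnn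
    rw [quad_smul] at h1
    rw [← hn2]
    calc quad A v = (n⁻¹ ^ 2 * quad A v) * n ^ 2 := by field_simp
      _ ≤ κ * n ^ 2 := by gcongr

lemma abs_quad_le {d : ℕ} (A : Matrix (Fin d) (Fin d) ℝ) (v : Fin d → ℝ) (hv : nrm v = 1) :
    |quad A v| ≤ ∑ i, ∑ j, |A i j| := by
  have h1 := ip_self_of_nrm hv
  have hi : ∀ i, |v i| ≤ 1 := fun i => by
    have : v i * v i ≤ ip v v :=
      Finset.single_le_sum (f := fun i => v i * v i) (fun i _ => mul_self_nonneg (v i))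
        (Finset.mem_univ i)
    rw [← sq_le_one_iff_abs_le_one]
    nlinarith
  have : quad A v = ∑ i, ∑ j, v i * (A i j * v j) := by
    simp only [quad, ip, Matrix.mulVec, dotProduct, Finset.mul_sum]
  rw [this]
  refine (Finset.abs_sum_le_sum_abs _ _).trans (Finset.sum_le_sum fun i _ => ?_)
  refine (Finset.abs_sum_le_sum_abs _ _).trans (Finset.sum_le_sum fun j _ => ?_)
  rw [abs_mul, abs_mul]
  have h2 : |A i j| * |v j| ≤ |A i j| := mul_le_of_le_one_right (abs_nonneg _) (hi j)
  exact (mul_le_of_le_one_left (by positivity) (hi i)).trans h2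

lemma abs_quad_le_rho {d : ℕ} (A : Matrix (Fin d) (Fin d) ℝ) (S : Set (Fin d → ℝ))
    (v : Fin d → ℝ) (hS : v ∈ S) (hv : nrm v = 1) : |quad A v| ≤ rho A S := by
  refine le_csSup ⟨∑ i, ∑ j, |A i j|, ?_⟩ ⟨v, hS, hv, rfl⟩
  rintro x ⟨w, _, hw, rfl⟩
  exact abs_quad_le A w hw

lemma quad_neg' {d : ℕ} (A : Matrix (Fin d) (Fin d) ℝ) (v : Fin d → ℝ) :
    quad (-A) v = - quad A v := by
  change v ⬝ᵥ ((-A) *ᵥ v) = - (v ⬝ᵥ (A *ᵥ v))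
  rw [Matrix.neg_mulVec, dotProduct_neg]

/-- Polarized bound. -/
lemma abs_bil_le {d : ℕ} (A : Matrix (Fin d) (Fin d) ℝ) (hA : A.IsSymm)
    (F : Submodule ℝ (Fin d → ℝ)) (x y : Fin d → ℝ) (hx : x ∈ F) (hy : y ∈ F)
    (a b : ℝ) (ha : 0 < a) (hb : 0 < b) (hxa : ip x x = a ^ 2) (hyb : ip y y = b ^ 2) :
    |ip x (A.mulVec y)| ≤ rho A (F : Set (Fin d → ℝ)) * (a * b) := by
  have up := quad_le_of_unit A F (rho A (F : Set (Fin d → ℝ)))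
    (fun v hv h => (le_abs_self _).trans (abs_quad_le_rho A F v hv h))
  have lo := quad_le_of_unit (-A) F (rho A (F : Set (Fin d → ℝ)))
    (fun v hv h => by
      rw [quad_neg']; exact (neg_le_abs _).trans (abs_quad_le_rho A F v hv h))
  have m1 : b • x + a • y ∈ F := F.add_mem (F.smul_mem _ hx) (F.smul_mem _ hy)
  have m2 : b • x + (-a) • y ∈ F := F.add_mem (F.smul_mem _ hx) (F.smul_mem _ hy)
  have u1 := up _ m1
  have u2 := up _ m2
  have l1 := lo _ m1
  have l2 := lo _ m2
  rw [quad_neg'] at l1 l2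
  rw [quad_lin A hA, ip_lin, hxa, hyb] at u1 u2 l1 l2
  have hab : 0 < a * b := mul_pos ha hb
  rw [abs_le]
  constructor
  · refine le_of_mul_le_mul_left ?_ hab
    nlinarith
  · refine le_of_mul_le_mul_left ?_ hab
    nlinarith

lemma bil_W {d : ℕ} (vstar : Fin d → ℝ) (lam : ℝ) (S : Matrix (Fin d) (Fin d) ℝ)
    (x y : Fin d → ℝ) :
    ip x ((S - spikedCov lam vstar).mulVec y) =
      ip x (S.mulVec y) - lam * (ip x vstar * ip vstar y) - ip x y := by
  change x ⬝ᵥ ((S - spikedCov lam vstar) *ᵥ y) =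
    x ⬝ᵥ (S *ᵥ y) - lam * ((x ⬝ᵥ vstar) * (vstar ⬝ᵥ y)) - x ⬝ᵥ y
  simp only [spikedCov, Matrix.sub_mulVec, Matrix.add_mulVec, Matrix.smul_mulVec,
    Matrix.one_mulVec, Matrix.vecMulVec_mulVec, dotProduct_sub, dotProduct_add, dotProduct_smul,
    smul_eq_mul, op_smul_eq_smul]
  ring

lemma lin_zero (p q : ℝ) (h : ∀ t : ℝ, 0 ≤ 2 * t * p + t ^ 2 * q) : p = 0 := by
  by_contra hp
  have hq : 0 ≤ q := by nlinarith [h 1, h (-1)]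
  have h1 := h (-p / (q + 1))
  have hq1 : 0 < q + 1 := by linarith
  have h2 : 2 * (-p / (q + 1)) * p + (-p / (q + 1)) ^ 2 * q =
      - (p ^ 2 * (q + 2)) / (q + 1) ^ 2 := by
    field_simp
    ring
  rw [h2] at h1
  have : 0 < p ^ 2 * (q + 2) / (q + 1) ^ 2 := by positivity
  rw [neg_div] at h1
  linarith

/-- Lemma 4: estimation error of the restricted leading eigenvector. -/
theorem restricted_leading_eigvec_est
    {d : ℕ} (vstar : Fin d → ℝ) (hvstar_nrm : nrm vstar = 1)
    (lam : ℝ) (hlam : 0 < lam)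
    (Sighat : Matrix (Fin d) (Fin d) ℝ) (hSig : Sighat.IsSymm)
    (W : Matrix (Fin d) (Fin d) ℝ) (hW : W = Sighat - spikedCov lam vstar)
    (F : Submodule ℝ (Fin d → ℝ)) (hvstarF : vstar ∈ F)
    (vF : Fin d → ℝ) (hvF_mem : vF ∈ F) (hvF_nrm : nrm vF = 1)
    (hmax : ∀ v ∈ F, nrm v = 1 → quad Sighat v ≤ quad Sighat vF)
    (hpos : 0 ≤ ip vF vstar)
    (hgap : 2 * rho W (F : Set (Fin d → ℝ)) < lam) :
    nrm (vF - vstar) ≤ rho W (F : Set (Fin d → ℝ)) / (lam - 2 * rho W (F : Set (Fin d → ℝ))) := by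
  subst hW
  set W := Sighat - spikedCov lam vstar with hWdef
  set ρ := rho W (F : Set (Fin d → ℝ)) with hρ
  set c := ip vF vstar with hc
  have n1 := ip_self_of_nrm hvstar_nrm
  have n2 := ip_self_of_nrm hvF_nrm
  have hρ0 : 0 ≤ ρ := (abs_nonneg _).trans (abs_quad_le_rho W F vF hvF_mem hvF_nrm)
  have hcc : ip vstar vF = c := ip_comm' _ _
  have hWs : W.IsSymm := by
    refine hSig.sub ?_
    unfold spikedCov
    refine Matrix.IsSymm.add (Matrix.IsSymm.smul ?_ _) Matrix.isSymm_one
    ext i j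
    simp [Matrix.vecMulVec_apply, mul_comm]
  have top := quad_le_of_unit Sighat F _ hmax
  -- first order optimality condition
  have foc : quad Sighat vF * c - ip vF (Sighat.mulVec vstar) = 0 := by
    refine lin_zero _ (quad Sighat vF - quad Sighat vstar) fun t => ?_
    have h := top ((1 : ℝ) • vF + t • vstar)
      (F.add_mem (F.smul_mem _ hvF_mem) (F.smul_mem _ hvstarF))
    rw [quad_lin Sighat hSig, ip_lin, n1, n2] at h
    linarith
  have zoc := top vstar hvstarF
  rw [n1, mul_one] at zoc
  -- expressing everything through W
  have w1 : quad W vF = quad Sighat vF - lam * c ^ 2 - 1 := by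
    unfold quad
    rw [hWdef, bil_W, n2, hcc]
    ring
  have w2 : quad W vstar = quad Sighat vstar - lam - 1 := by
    unfold quad
    rw [hWdef, bil_W, n1]
    ring
  have w3 : ip vF (W.mulVec vstar) = ip vF (Sighat.mulVec vstar) - lam * c - c := by
    rw [hWdef, bil_W, n1]
    ring
  have hN2 : ip (vF - vstar) (vF - vstar) = 2 - 2 * c := by
    have h := ip_lin 1 (-1) 1 (-1) vF vstar
    simp only [one_smul, neg_smul, ← sub_eq_add_neg] at h
    rw [h, n1, n2]
    ring
  have hP2 : ip (vF + vstar) (vF + vstar) = 2 + 2 * c := by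
    have h := ip_lin 1 1 1 1 vF vstar
    simp only [one_smul] at h
    rw [h, n1, n2]
    ring
  have hc1 : c ≤ 1 := by
    have := ip_self_nonneg (vF - vstar)
    linarith
  have hD : 0 < lam - 2 * ρ := by linarith
  rw [le_div_iff₀ hD, nrm_eq, hN2]
  rcases hc1.eq_or_lt with hceq | hclt
  · rw [hceq]
    simpa using hρ0
  set N := Real.sqrt (2 - 2 * c) with hN
  set P := Real.sqrt (2 + 2 * c) with hP
  set s := Real.sqrt (1 - c ^ 2) with hs
  have N2 : N ^ 2 = 2 - 2 * c := Real.sq_sqrt (by linarith)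
  have P2 : P ^ 2 = 2 + 2 * c := Real.sq_sqrt (by linarith)
  have s2 : s ^ 2 = 1 - c ^ 2 := Real.sq_sqrt (by nlinarith)
  have Npos : 0 < N := Real.sqrt_pos.mpr (by linarith)
  have Ppos : 0 < P := Real.sqrt_pos.mpr (by linarith)
  have spos : 0 < s := Real.sqrt_pos.mpr (by nlinarith)
  have hNP : N * P = 2 * s := by
    rw [← sq_eq_sq₀ (by positivity) (by positivity), mul_pow, mul_pow, N2, P2, s2]
    ring
  -- first bound
  have b1 : lam * c * s ≤ ρ := by
    have hm : (-c) • vF + (1 : ℝ) • vstar ∈ F :=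
      F.add_mem (F.smul_mem _ hvF_mem) (F.smul_mem _ hvstarF)
    have hn : ip ((-c) • vF + (1 : ℝ) • vstar) ((-c) • vF + (1 : ℝ) • vstar) = s ^ 2 := by
      rw [ip_lin, n1, n2, s2]
      ring
    have h := abs_bil_le W hWs F vF _ hvF_mem hm 1 s one_pos spos (by rw [n2]; ring) hn
    have e := bil_lin W 1 0 (-c) 1 vF vstar
    rw [one_smul, zero_smul, add_zero] at e
    rw [e, w1, w3, ← hρ] at h
    have h' := (abs_le.mp h).1
    have : lam * c * s * s ≤ ρ * s := by
      have : lam * c * s * s = lam * c * (1 - c ^ 2) := by rw [← s2]; ring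
      rw [this]
      linarith
    exact le_of_mul_le_mul_right this spos
  -- second bound
  have b2 : lam * s ≤ 2 * ρ := by
    have h := abs_bil_le W hWs F (vF - vstar) (vF + vstar) (F.sub_mem hvF_mem hvstarF)
      (F.add_mem hvF_mem hvstarF) N P Npos Ppos (by rw [hN2, N2]) (by rw [hP2, P2])
    have e := bil_lin W 1 (-1) 1 1 vF vstar
    simp only [one_smul, neg_smul, ← sub_eq_add_neg] at e
    rw [e, bil_symm W hWs vF vstar, hNP, w1, w2, ← hρ] at h
    have h' := (abs_le.mp h).2
    have : lam * s * s ≤ 2 * ρ * s := by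
      have : lam * s * s = lam * (1 - c ^ 2) := by rw [← s2]; ring
      rw [this]
      linarith
    exact le_of_mul_le_mul_right this spos
  have b3 : lam - 2 * ρ ≤ lam * c ^ 2 := by
    refine le_of_mul_le_mul_left ?_ hlam
    have h4 : (lam * s) ^ 2 ≤ (2 * ρ) ^ 2 := by gcongr
    rw [mul_pow, s2] at h4
    nlinarith
  have b4 : N * c ≤ s := by
    rw [← sq_le_sq₀ (by positivity) (by positivity), mul_pow, N2, s2]
    have : 1 - c ^ 2 - (2 - 2 * c) * c ^ 2 = (1 - c) * ((1 - c) * (1 + 2 * c)) := by ring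
    have h5 : 0 ≤ (1 - c) * ((1 - c) * (1 + 2 * c)) := by
      have : 0 < 1 - c := by linarith
      positivity
    linarith
  calc N * (lam - 2 * ρ) ≤ N * (lam * c ^ 2) := by gcongr
    _ = lam * c * (N * c) := by ring
    _ ≤ lam * c * s := by gcongr
    _ ≤ ρ := b1

end StructuredPCA
end
end
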